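/- arXiv:1111.4206 — 6 statements merged into one kernel-verified Lean document; each statement's English description precedes it below -/
import Mathlib

section
/- Let X be a compact metric space and f : X → X a homeomorphism. If (Λ_0, …, Λ_{ℓ−1}) and (Λ'_0, …, Λ'_{ℓ'−1}) are two cyclic mixing decompositions for f, of lengths ℓ ≥ 1 and ℓ' ≥ 1 respectively, then ℓ = ℓ' and there exists an integer s such that Λ'_j = Λ_{(j+s) mod ℓ} for every 0 ≤ j < ℓ; that is, the decomposition is unique up to a cyclic shift of the indexing. -/
/-- The restriction of the map `g` to the subset `h` (with its subspace topology)
is topologically mixing: for any nonempty open subsets `U ∩ h`, `V ∩ h` of `h`,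
there is `n₀ ≥ 1` such that `g^n(U ∩ h)` meets `V ∩ h` for all `n ≥ n₀`. -/
def TopMixingOn {X : Type*} [TopologicalSpace X] (g : X → X) (h : Set X) : Prop :=
  ∀ U V : Set X, IsOpen U → IsOpen V → (U ∩ h).Nonempty → (V ∩ h).Nonempty →
    ∃ n₀ : ℕ, 1 ≤ n₀ ∧ ∀ n : ℕ, n₀ ≤ n → (g^[n] '' (U ∩ h) ∩ (V ∩ h)).Nonempty

/-- A cyclic mixing decomposition of length `ℓ ≥ 1` for `f`: pairwise disjoint nonempty
closed subsets `Λ 0, …, Λ (ℓ-1)` covering the space, cyclically permuted by `f`,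
with `f^ℓ` topologically mixing on each piece. -/
def IsCyclicMixingDecomp {X : Type*} [TopologicalSpace X] (f : X → X) (ℓ : ℕ)
    (Λ : ℕ → Set X) : Prop :=
  1 ≤ ℓ ∧
  (∀ i < ℓ, (Λ i).Nonempty) ∧
  (∀ i < ℓ, IsClosed (Λ i)) ∧
  (∀ i < ℓ, ∀ j < ℓ, i ≠ j → Disjoint (Λ i) (Λ j)) ∧
  (⋃ i ∈ Finset.range ℓ, Λ i) = Set.univ ∧
  (∀ i < ℓ, f '' Λ i = Λ ((i + 1) % ℓ)) ∧
  (∀ i < ℓ, TopMixingOn (f^[ℓ]) (Λ i))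

namespace IsCyclicMixingDecomp

variable {X : Type*} [TopologicalSpace X] {f : X → X} {ℓ ℓ' : ℕ} {Λ Λ' : ℕ → Set X}

theorem image_iterate (h : IsCyclicMixingDecomp f ℓ Λ) {i : ℕ} (hi : i < ℓ) (k : ℕ) :
    f^[k] '' Λ i = Λ ((i + k) % ℓ) := by
  obtain ⟨hℓ, -, -, -, -, him, -⟩ := h
  induction k with
  | zero => simp [Nat.mod_eq_of_lt hi]
  | succ k ih =>
    rw [Function.iterate_succ', Set.image_comp, ih, him _ (Nat.mod_lt _ hℓ), Nat.mod_add_mod,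
      add_assoc]

theorem exists_mem (h : IsCyclicMixingDecomp f ℓ Λ) (x : X) : ∃ i < ℓ, x ∈ Λ i := by
  obtain ⟨-, -, -, -, hcov, -, -⟩ := h
  have hx : x ∈ ⋃ i ∈ Finset.range ℓ, Λ i := hcov ▸ Set.mem_univ x
  simpa using hx

theorem eq_of_mem (h : IsCyclicMixingDecomp f ℓ Λ) {i j : ℕ} (hi : i < ℓ) (hj : j < ℓ) {x : X}
    (hxi : x ∈ Λ i) (hxj : x ∈ Λ j) : i = j := by
  obtain ⟨-, -, -, hdisj, -⟩ := h
  by_contra hij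
  exact Set.disjoint_left.mp (hdisj i hi j hj hij) hxi hxj

theorem injOn (h : IsCyclicMixingDecomp f ℓ Λ) : Set.InjOn Λ (Set.Iio ℓ) := by
  intro i hi j hj hij
  obtain ⟨x, hx⟩ := h.2.1 i hi
  exact h.eq_of_mem hi hj hx (hij ▸ hx)

theorem isOpen (h : IsCyclicMixingDecomp f ℓ Λ) {i : ℕ} (hi : i < ℓ) : IsOpen (Λ i) := by
  have hcompl : (Λ i)ᶜ = ⋃ j ∈ (Finset.range ℓ).erase i, Λ j := by
    ext x
    simp only [Set.mem_compl_iff, Set.mem_iUnion, Finset.mem_erase, Finset.mem_range, exists_prop]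
    constructor
    · intro hx
      obtain ⟨j, hj, hxj⟩ := h.exists_mem x
      exact ⟨j, ⟨fun hji => hx (hji ▸ hxj), hj⟩, hxj⟩
    · rintro ⟨j, ⟨hji, hj⟩, hxj⟩ hxi
      exact hji (h.eq_of_mem hj hi hxj hxi)
  rw [← isClosed_compl_iff, hcompl]
  refine isClosed_biUnion_finset fun j hj => h.2.2.1 j ?_
  simpa using Finset.mem_of_mem_erase hj

/-- A piece of one decomposition that meets a piece of another one is contained in it. -/
theorem subset_of_mem (h : IsCyclicMixingDecomp f ℓ Λ) (h' : IsCyclicMixingDecomp f ℓ' Λ')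
    {i j : ℕ} (hi : i < ℓ) (hj : j < ℓ') {x : X} (hx : x ∈ Λ i) (hx' : x ∈ Λ' j) :
    Λ i ⊆ Λ' j := by
  intro y hy
  by_contra hy'
  obtain ⟨n, -, hn⟩ := h.2.2.2.2.2.2 i hi (Λ' j) (Λ' j)ᶜ (h'.isOpen hj)
    (h'.2.2.1 j hj).isOpen_compl ⟨x, hx', hx⟩ ⟨y, hy', hy⟩
  obtain ⟨_, ⟨z, ⟨hz, -⟩, rfl⟩, hz', -⟩ := hn (ℓ' * n) (Nat.le_mul_of_pos_left n h'.1)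
  apply hz'
  have himage := h'.image_iterate hj (ℓ * (ℓ' * n))
  rw [Nat.mul_left_comm, Nat.add_mul_mod_self_left, Nat.mod_eq_of_lt hj,
    ← Nat.mul_left_comm, Function.iterate_mul] at himage
  exact himage ▸ Set.mem_image_of_mem _ hz

end IsCyclicMixingDecomp

/-- Uniqueness of the cyclic mixing decomposition, up to a cyclic shift of the indexing. -/
theorem uniqueness_of_cyclic_mixing_decomposition
    {X : Type*} [MetricSpace X] [CompactSpace X] (f : X ≃ₜ X)
    (ℓ ℓ' : ℕ) (Λ Λ' : ℕ → Set X)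
    (hΛ : IsCyclicMixingDecomp (⇑f) ℓ Λ) (hΛ' : IsCyclicMixingDecomp (⇑f) ℓ' Λ') :
    ℓ = ℓ' ∧ ∃ s : ℕ, ∀ j < ℓ, Λ' j = Λ ((j + s) % ℓ) := by
  obtain ⟨x, hx⟩ := hΛ'.2.1 0 hΛ'.1
  obtain ⟨s, hs, hxs⟩ := hΛ.exists_mem x
  have hbase : Λ' 0 = Λ s :=
    (hΛ'.subset_of_mem hΛ hΛ'.1 hs hx hxs).antisymm (hΛ.subset_of_mem hΛ' hs hΛ'.1 hxs hx)
  have hshift (k : ℕ) : Λ' (k % ℓ') = Λ ((k + s) % ℓ) := by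
    rw [add_comm k s, ← hΛ.image_iterate hs, ← hbase, hΛ'.image_iterate hΛ'.1, zero_add]
  have hdvd' : ℓ' ∣ ℓ := by
    refine Nat.dvd_of_mod_eq_zero (hΛ'.injOn (Nat.mod_lt _ hΛ'.1) hΛ'.1 ?_)
    rw [hshift, hbase, Nat.add_mod_left, Nat.mod_eq_of_lt hs]
  have hdvd : ℓ ∣ ℓ' := by
    have hmod : (ℓ' + s) % ℓ = s := by
      refine hΛ.injOn (Nat.mod_lt _ hΛ.1) hs ?_
      rw [← hshift, Nat.mod_self, hbase]
    have hmodEq : 0 + s ≡ ℓ' + s [MOD ℓ] := by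
      rw [Nat.ModEq, hmod, zero_add, Nat.mod_eq_of_lt hs]
    exact (Nat.modEq_zero_iff_dvd).mp (Nat.ModEq.add_right_cancel' s hmodEq).symm
  obtain rfl := Nat.dvd_antisymm hdvd hdvd'
  exact ⟨rfl, s, fun j hj => by rw [← hshift, Nat.mod_eq_of_lt hj]⟩
end

section
/- Let X be a compact metric space, f : X → X a homeomorphism, ℓ ≥ 1 an integer, and h ⊆ X a nonempty closed subset such that f^ℓ(h) = h, X = h ∪ f(h) ∪ … ∪ f^{ℓ−1}(h), and the restriction of f^ℓ to h is topologically mixing. Then f is topologically transitive on X. -/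
/-- If `X = h ∪ f(h) ∪ … ∪ f^{ℓ-1}(h)` with `f^ℓ(h) = h` and `f^ℓ` topologically mixing
on `h`, then `f` is topologically transitive on `X`. -/
theorem transitive_of_cyclic_mixing_piece
    {X : Type*} [MetricSpace X] [CompactSpace X] (f : X ≃ₜ X)
    (ℓ : ℕ) (hℓ : 1 ≤ ℓ) (h : Set X) (hne : h.Nonempty) (hcl : IsClosed h)
    (hinv : (⇑f)^[ℓ] '' h = h)
    (hcover : (⋃ k ∈ Finset.range ℓ, (⇑f)^[k] '' h) = Set.univ)
    (hmix : TopMixingOn ((⇑f)^[ℓ]) h) :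
    ∀ U V : Set X, IsOpen U → IsOpen V → U.Nonempty → V.Nonempty →
      ∃ n : ℕ, 1 ≤ n ∧ ((⇑f)^[n] '' U ∩ V).Nonempty := by
  intro U V hU hV ⟨u, hu⟩ ⟨v, hv⟩
  have mem_piece : ∀ x : X, ∃ k, ∃ y ∈ h, (⇑f)^[k] y = x := fun x => by
    have hx : x ∈ ⋃ k ∈ Finset.range ℓ, (⇑f)^[k] '' h := hcover ▸ Set.mem_univ x
    simp only [Set.mem_iUnion] at hx
    obtain ⟨k, -, y, hy, hyx⟩ := hx
    exact ⟨k, y, hy, hyx⟩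
  obtain ⟨i, a, ha, rfl⟩ := mem_piece u
  obtain ⟨j, b, hb, rfl⟩ := mem_piece v
  obtain ⟨n₀, -, hn₀⟩ := hmix _ _ (hU.preimage (f.continuous.iterate i))
    (hV.preimage (f.continuous.iterate j)) ⟨a, hu, ha⟩ ⟨b, hv, hb⟩
  obtain ⟨_, ⟨x, ⟨hxU, -⟩, rfl⟩, hxV, -⟩ := hn₀ (n₀ + i + 1) (by omega)
  have hle : n₀ + i + 1 ≤ ℓ * (n₀ + i + 1) := Nat.le_mul_of_pos_left _ hℓ
  refine ⟨j + ℓ * (n₀ + i + 1) - i, by omega, _, ⟨_, hxU, rfl⟩, ?_⟩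
  rw [← Function.iterate_add_apply, Nat.sub_add_cancel (by omega)]
  rwa [Set.mem_preimage, ← Function.iterate_mul, ← Function.iterate_add_apply] at hxV
end

section
/- Let X be a compact metric space, f : X → X a homeomorphism, ℓ ≥ 1 an integer, and h ⊆ X a nonempty closed subset such that f^ℓ(h) = h, X = h ∪ f(h) ∪ … ∪ f^{ℓ−1}(h), and the restriction of f^ℓ to h is topologically mixing. Then the interior of h in X is nonempty and dense in h; consequently, for each 0 ≤ k < ℓ, the interior of f^k(h) in X is nonempty and dense in f^k(h). -/
theorem Homeomorph.iterate_image_interior {X : Type*} [TopologicalSpace X] (f : X ≃ₜ X)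
    (n : ℕ) (s : Set X) : f^[n] '' interior s = interior (f^[n] '' s) := by
  induction n generalizing s with
  | zero => simp
  | succ n ih =>
    rw [Function.iterate_succ, Set.image_comp, Set.image_comp, f.image_interior, ih]

theorem Homeomorph.iterate_image_closure {X : Type*} [TopologicalSpace X] (f : X ≃ₜ X)
    (n : ℕ) (s : Set X) : f^[n] '' closure s = closure (f^[n] '' s) := by
  induction n generalizing s with
  | zero => simp
  | succ n ih =>
    rw [Function.iterate_succ, Set.image_comp, Set.image_comp, f.image_closure, ih]

/-- In a mixing piece that is invariant under a map commuting with taking interiors,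
a nonempty interior is dense. -/
theorem TopMixingOn.subset_closure_interior {X : Type*} [TopologicalSpace X] {g : X → X}
    {h : Set X} (hmix : TopMixingOn g h) (hg : g '' interior h ⊆ interior h)
    (hint : (interior h).Nonempty) : h ⊆ closure (interior h) := by
  intro x hx
  refine mem_closure_iff.2 fun U hU hxU => ?_
  have hV : (interior h ∩ h).Nonempty := hint.mono fun y hy => ⟨hy, interior_subset hy⟩
  obtain ⟨n, -, hn⟩ := hmix (interior h) U isOpen_interior hU hV ⟨x, hxU, hx⟩
  obtain ⟨_, ⟨y, hy, rfl⟩, hyU⟩ := hn n le_rfl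
  exact ⟨_, hyU.1, (Set.mapsTo_iff_image_subset.2 hg).iterate n hy.1⟩

/-- Under the cyclic covering hypotheses, the interior of `h` in `X` is nonempty and
dense in `h`, and similarly for each iterate `f^k(h)`, `0 ≤ k < ℓ`. -/
theorem interior_nonempty_dense_of_cyclic_mixing_piece
    {X : Type*} [MetricSpace X] [CompactSpace X] (f : X ≃ₜ X)
    (ℓ : ℕ) (hℓ : 1 ≤ ℓ) (h : Set X) (hne : h.Nonempty) (hcl : IsClosed h)
    (hinv : (⇑f)^[ℓ] '' h = h)
    (hcover : (⋃ k ∈ Finset.range ℓ, (⇑f)^[k] '' h) = Set.univ)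
    (hmix : TopMixingOn ((⇑f)^[ℓ]) h) :
    ((interior h).Nonempty ∧ h ⊆ closure (interior h)) ∧
    ∀ k < ℓ, (interior ((⇑f)^[k] '' h)).Nonempty ∧
      (⇑f)^[k] '' h ⊆ closure (interior ((⇑f)^[k] '' h)) := by
  have hX : Nonempty X := ⟨hne.some⟩
  have hint : (interior h).Nonempty := by
    obtain ⟨k, hk⟩ := nonempty_interior_of_iUnion_of_closed
      (f := fun k : Fin ℓ => f^[k] '' h)
      (fun k => by
        rw [← hcl.closure_eq, f.iterate_image_closure]
        exact isClosed_closure)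
      (by
        rw [← hcover]
        ext x
        simp [Fin.exists_iff])
    rw [← f.iterate_image_interior] at hk
    exact hk.of_image
  have hdense : h ⊆ closure (interior h) := by
    refine hmix.subset_closure_interior ?_ hint
    rw [f.iterate_image_interior, hinv]
  refine ⟨⟨hint, hdense⟩, fun k _ => ?_⟩
  rw [← f.iterate_image_interior, ← f.iterate_image_closure]
  exact ⟨hint.image _, Set.image_mono hdense⟩
end

section
/- Let X be a compact metric space, f : X → X a homeomorphism, ℓ ≥ 1 an integer, and h ⊆ X a nonempty closed subset such that f^ℓ(h) = h, X = h ∪ f(h) ∪ … ∪ f^{ℓ−1}(h), and the restriction of f^ℓ to h is topologically mixing. Then for all 0 ≤ j, k < ℓ, if the intersection f^j(h) ∩ f^k(h) has nonempty interior in X, then f^j(h) = f^k(h). -/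
/-- If `g` is topologically mixing on `h` and `p` is continuous and commutes with `g`, then a closed
forward `g`-invariant set `B` containing `p x` for all `x` in a nonempty relatively open subset of `h`
contains `p '' h`. -/
theorem TopMixingOn.image_subset_of_mapsTo {X : Type*} [TopologicalSpace X] {g p : X → X}
    {h U B : Set X} (hmix : TopMixingOn g h) (hp : Continuous p) (hpg : Function.Commute p g)
    (hB : IsClosed B) (hgB : Set.MapsTo g B B) (hU : IsOpen U) (hUne : (U ∩ h).Nonempty)
    (hUB : Set.MapsTo p (U ∩ h) B) : p '' h ⊆ B := by
  rintro _ ⟨x, hx, rfl⟩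
  rw [← hB.closure_eq, mem_closure_iff]
  intro V hV hxV
  obtain ⟨n, -, hn⟩ := hmix U (p ⁻¹' V) hU (hV.preimage hp) hUne ⟨x, hxV, hx⟩
  obtain ⟨_, ⟨y, hy, rfl⟩, hyV, -⟩ := hn n le_rfl
  refine ⟨p (g^[n] y), hyV, ?_⟩
  rw [(hpg.iterate_right n).eq y]
  exact hgB.iterate n (hUB hy)

/-- If `f^ℓ` maps `h` onto itself and is topologically mixing on `h`, and `f^j(h) ∩ f^k(h)` has
nonempty interior, then `f^j(h) ⊆ f^k(h)`. -/
theorem iterate_image_subset_of_interior_nonempty {X : Type*} [TopologicalSpace X] (f : X ≃ₜ X)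
    {ℓ : ℕ} {h : Set X} (hcl : IsClosed h) (hinv : (⇑f)^[ℓ] '' h = h)
    (hmix : TopMixingOn ((⇑f)^[ℓ]) h) {j k : ℕ}
    (hjk : (interior ((⇑f)^[j] '' h ∩ (⇑f)^[k] '' h)).Nonempty) :
    (⇑f)^[j] '' h ⊆ (⇑f)^[k] '' h := by
  have hcomm (m : ℕ) : Function.Commute (⇑f)^[m] (⇑f)^[ℓ] :=
    Function.Commute.iterate_iterate_self (⇑f) m ℓ
  have hclosed : IsClosed ((⇑f)^[k] '' h) := by
    clear hjk
    induction k with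
    | zero => simpa using hcl
    | succ k ih =>
      rw [Function.iterate_succ', Set.image_comp]
      exact f.isClosedMap _ ih
  have hcont : Continuous (⇑f)^[j] := f.continuous.iterate j
  have hopen : IsOpen ((⇑f)^[j] ⁻¹' interior ((⇑f)^[j] '' h ∩ (⇑f)^[k] '' h)) :=
    isOpen_interior.preimage hcont
  refine hmix.image_subset_of_mapsTo hcont (hcomm j) hclosed ?_ hopen ?_
    fun x hx => (interior_subset hx.1).2
  · rintro _ ⟨y, hy, rfl⟩
    exact ⟨(⇑f)^[ℓ] y, hinv ▸ Set.mem_image_of_mem _ hy, (hcomm k).eq y⟩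
  · obtain ⟨z, hz⟩ := hjk
    obtain ⟨y, hy, rfl⟩ := (interior_subset hz).1
    exact ⟨y, hz, hy⟩

/-- Under the cyclic covering hypotheses, if `f^j(h) ∩ f^k(h)` has nonempty interior
in `X`, then `f^j(h) = f^k(h)`. -/
theorem iterate_images_eq_of_interior_nonempty
    {X : Type*} [MetricSpace X] [CompactSpace X] (f : X ≃ₜ X)
    (ℓ : ℕ) (hℓ : 1 ≤ ℓ) (h : Set X) (hne : h.Nonempty) (hcl : IsClosed h)
    (hinv : (⇑f)^[ℓ] '' h = h)
    (hcover : (⋃ k ∈ Finset.range ℓ, (⇑f)^[k] '' h) = Set.univ)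
    (hmix : TopMixingOn ((⇑f)^[ℓ]) h) :
    ∀ j < ℓ, ∀ k < ℓ,
      (interior ((⇑f)^[j] '' h ∩ (⇑f)^[k] '' h)).Nonempty →
        (⇑f)^[j] '' h = (⇑f)^[k] '' h := by
  intro j _ k _ hjk
  exact (iterate_image_subset_of_interior_nonempty f hcl hinv hmix hjk).antisymm
    (iterate_image_subset_of_interior_nonempty f hcl hinv hmix (Set.inter_comm _ _ ▸ hjk))
end

section
/- Let X be a Baire topological space, Y a compact metric space, and F a map assigning to each x ∈ X a nonempty closed subset F(x) ⊆ Y. Assume F is lower semicontinuous: for every open set U ⊆ Y, the set {x ∈ X : F(x) ∩ U ≠ ∅} is open in X. Then there is a dense Gδ subset R ⊆ X such that F is continuous at every point x₀ ∈ R with respect to the Hausdorff distance: for every ε > 0 there is a neighborhood N of x₀ such that the Hausdorff distance between F(x) and F(x₀) is less than ε for all x ∈ N. -/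
open Filter Topology in
/-- Away from its frontier, membership in a set is locally constant. -/
theorem eventually_mem_iff_of_notMem_frontier {X : Type*} [TopologicalSpace X] {s : Set X}
    {x₀ : X} (h : x₀ ∉ frontier s) : ∀ᶠ x in 𝓝 x₀, (x ∈ s ↔ x₀ ∈ s) := by
  have h' : x₀ ∈ interior s ∪ interior sᶜ := by
    rwa [← compl_frontier_eq_union_interior]
  rcases h' with h' | h'
  · filter_upwards [mem_interior_iff_mem_nhds.1 h'] with x hx
    exact iff_of_true hx (interior_subset h')
  · filter_upwards [mem_interior_iff_mem_nhds.1 h'] with x hx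
    exact iff_of_false hx (interior_subset h')

/-- If every member of a family of sets of small diameter covering `s ∪ t` that meets one of
`s`, `t` also meets the other, then `s` and `t` are close in the Hausdorff distance. -/
theorem hausdorffDist_le_of_cover {ι Y : Type*} [PseudoMetricSpace Y] {s t : Set Y}
    {U : ι → Set Y} {r : ℝ} (hr : 0 ≤ r) (hcover : s ∪ t ⊆ ⋃ i, U i)
    (hdist : ∀ i, ∀ y ∈ U i, ∀ z ∈ U i, dist y z ≤ r)
    (hmeet : ∀ i, (s ∩ U i).Nonempty ↔ (t ∩ U i).Nonempty) :
    Metric.hausdorffDist s t ≤ r := by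
  refine Metric.hausdorffDist_le_of_mem_dist hr (fun y hy => ?_) (fun y hy => ?_)
  · obtain ⟨i, hi⟩ := Set.mem_iUnion.1 (hcover (Or.inl hy))
    obtain ⟨z, hz, hzi⟩ := (hmeet i).1 ⟨y, hy, hi⟩
    exact ⟨z, hz, hdist i y hi z hzi⟩
  · obtain ⟨i, hi⟩ := Set.mem_iUnion.1 (hcover (Or.inr hy))
    obtain ⟨z, hz, hzi⟩ := (hmeet i).2 ⟨y, hy, hi⟩
    exact ⟨z, hz, hdist i y hi z hzi⟩

/-- A lower semicontinuous map from a Baire space to the nonempty closed subsets of a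
compact metric space is continuous (for the Hausdorff distance) on a dense `Gδ` set. -/
theorem lsc_setValued_continuous_on_dense_Gdelta
    {X Y : Type*} [TopologicalSpace X] [BaireSpace X]
    [MetricSpace Y] [CompactSpace Y]
    (F : X → Set Y) (hFne : ∀ x, (F x).Nonempty) (hFcl : ∀ x, IsClosed (F x))
    (hlsc : ∀ U : Set Y, IsOpen U → IsOpen {x : X | (F x ∩ U).Nonempty}) :
    ∃ R : Set X, Dense R ∧ IsGδ R ∧
      ∀ x₀ ∈ R, ∀ ε : ℝ, 0 < ε → ∃ N ∈ nhds x₀, ∀ x ∈ N,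
        Metric.hausdorffDist (F x) (F x₀) < ε := by
  let B := TopologicalSpace.countableBasis Y
  have hB : TopologicalSpace.IsTopologicalBasis B :=
    TopologicalSpace.isBasis_countableBasis Y
  have hBc : B.Countable := TopologicalSpace.countable_countableBasis Y
  have hopen : ∀ U ∈ B, IsOpen (frontier {x : X | (F x ∩ U).Nonempty})ᶜ :=
    fun _ _ => isClosed_frontier.isOpen_compl
  refine ⟨⋂ U ∈ B, (frontier {x : X | (F x ∩ U).Nonempty})ᶜ,
    dense_biInter_of_isOpen hopen hBc fun U hU => ?_,
    .biInter hBc fun U hU => (hopen U hU).isGδ, fun x₀ hx₀ ε hε => ?_⟩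
  · rw [← interior_eq_empty_iff_dense_compl, ← frontier_compl]
    exact interior_frontier (hlsc U (hB.isOpen hU)).isClosed_compl
  · choose U hUB hyU hUball using fun y : Y =>
      hB.exists_subset_of_mem_open (Metric.mem_ball_self (x := y) (by positivity : 0 < ε / 4))
        Metric.isOpen_ball
    obtain ⟨t, ht⟩ := isCompact_univ.elim_finite_subcover U (fun y => hB.isOpen (hUB y))
      fun y _ => Set.mem_iUnion.2 ⟨y, hyU y⟩
    have hev : ∀ᶠ x in nhds x₀, ∀ y ∈ t, ((F x ∩ U y).Nonempty ↔ (F x₀ ∩ U y).Nonempty) :=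
      (Filter.eventually_all_finset t).2 fun y _ =>
        eventually_mem_iff_of_notMem_frontier (Set.mem_iInter₂.1 hx₀ (U y) (hUB y))
    refine ⟨_, hev, fun x hx => ?_⟩
    have hle : Metric.hausdorffDist (F x) (F x₀) ≤ ε / 2 := by
      refine hausdorffDist_le_of_cover (U := fun y : t => U y) (by positivity)
        (fun z _ => ?_) (fun y a ha b hb => ?_) fun y => hx y y.2
      · simpa using ht (Set.mem_univ z)
      · have ha' := Metric.mem_ball.1 (hUball y ha)
        have hb' := Metric.mem_ball.1 (hUball y hb)
        linarith [dist_triangle_right a b (y : Y)]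
    linarith
end

section
/- Let X be a compact metric space, f : X → X a homeomorphism, ℓ ≥ 1 an integer, and h ⊆ X a nonempty closed subset such that f^ℓ(h) = h, X = h ∪ f(h) ∪ … ∪ f^{ℓ−1}(h), and the restriction of f^ℓ to h is topologically mixing. Then there exists a divisor d of ℓ such that the sets h, f(h), …, f^{d−1}(h) are exactly the distinct sets among the iterates f^k(h), k ∈ ℤ; moreover f^d(h) = h and the restriction of f^d to h is topologically mixing. -/
/-- If `g` is continuous, maps `h` onto itself, and some positive iterate of `g` is topologically
mixing on `h`, then so is `g`. -/
theorem TopMixingOn.of_iterate {X : Type*} [TopologicalSpace X] {g : X → X} {h : Set X}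
    (hg : Continuous g) (hinv : g '' h = h) {m : ℕ} (hm : 0 < m)
    (hmix : TopMixingOn (g^[m]) h) : TopMixingOn g h := by
  intro U V hU hV hUh hVh
  have hiter (r : ℕ) : g^[r] '' h = h := by
    rw [Set.image_iterate_eq]
    exact Function.iterate_fixed hinv r
  have hres (r : ℕ) : ∀ᶠ n in Filter.atTop,
      ((g^[m])^[n] '' (U ∩ h) ∩ (g^[r] ⁻¹' V ∩ h)).Nonempty := by
    have hpre : (g^[r] ⁻¹' V ∩ h).Nonempty := by
      obtain ⟨y, hyV, hyh⟩ := hVh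
      obtain ⟨x, hx, rfl⟩ := (hiter r).ge hyh
      exact ⟨x, hyV, hx⟩
    obtain ⟨n₀, -, hn₀⟩ := hmix U _ hU (hV.preimage (hg.iterate r)) hUh hpre
    exact Filter.eventually_atTop.2 ⟨n₀, hn₀⟩
  obtain ⟨N, hN⟩ := Filter.eventually_atTop.1
    ((Filter.eventually_all_finset (Finset.range m)).2 fun r _ => hres r)
  refine ⟨m * N + 1, by omega, fun n hn => ?_⟩
  obtain ⟨y, ⟨x, hx, rfl⟩, hyV, hyh⟩ := hN (n / m)
    ((Nat.le_div_iff_mul_le hm).2 (by rw [mul_comm]; omega)) (n % m)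
    (Finset.mem_range.2 (Nat.mod_lt n hm))
  refine ⟨g^[n % m] ((g^[m])^[n / m] x), ⟨x, hx, ?_⟩, hyV, (hiter _).le ⟨_, hyh, rfl⟩⟩
  rw [← Function.iterate_mul, ← Function.iterate_add_apply, Nat.mod_add_div]

/-- Under the cyclic covering hypotheses, there is a divisor `d` of `ℓ` such that
`h, f(h), …, f^{d-1}(h)` are pairwise distinct and exhaust the iterates `f^k(h)`,
`k ∈ ℤ`; moreover `f^d(h) = h` and `f^d` is topologically mixing on `h`. -/
theorem exists_divisor_with_distinct_iterates
    {X : Type*} [MetricSpace X] [CompactSpace X] (f : X ≃ₜ X)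
    (ℓ : ℕ) (hℓ : 1 ≤ ℓ) (h : Set X) (hne : h.Nonempty) (hcl : IsClosed h)
    (hinv : (⇑f)^[ℓ] '' h = h)
    (hcover : (⋃ k ∈ Finset.range ℓ, (⇑f)^[k] '' h) = Set.univ)
    (hmix : TopMixingOn ((⇑f)^[ℓ]) h) :
    ∃ d : ℕ, d ∣ ℓ ∧
      (⇑f)^[d] '' h = h ∧
      TopMixingOn ((⇑f)^[d]) h ∧
      (∀ j < d, ∀ k < d, (⇑f)^[j] '' h = (⇑f)^[k] '' h → j = k) ∧
      (∀ k : ℤ, ∃ j < d, ⇑(f.toEquiv ^ k) '' h = (⇑f)^[j] '' h) := by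
  set d := Function.minimalPeriod (Set.image f) h
  have hper : Function.IsPeriodicPt (Set.image f) ℓ h := by
    rw [Function.IsPeriodicPt, Function.IsFixedPt, ← Set.image_iterate_eq, hinv]
  have hdvd : d ∣ ℓ := hper.minimalPeriod_dvd
  have hdpos : 0 < d := hper.minimalPeriod_pos hℓ
  have hdinv : (⇑f)^[d] '' h = h := by
    rw [Set.image_iterate_eq]
    exact Function.iterate_minimalPeriod
  refine ⟨d, hdvd, hdinv, ?_, ?_, fun k => ?_⟩
  · obtain ⟨m, hm⟩ := hdvd
    refine TopMixingOn.of_iterate (m := m) (f.continuous.iterate d) hdinv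
      (Nat.pos_of_ne_zero ?_) ?_
    · rintro rfl
      omega
    · rwa [← Function.iterate_mul, ← hm]
  · intro j hj k hk hjk
    rw [Set.image_iterate_eq, Set.image_iterate_eq] at hjk
    exact (Function.iterate_eq_iterate_iff_of_lt_minimalPeriod hj hk).1 hjk
  · have hdZ : (0 : ℤ) < d := by exact_mod_cast hdpos
    obtain ⟨j, hj⟩ := Int.eq_ofNat_of_zero_le (Int.emod_nonneg k hdZ.ne')
    refine ⟨j, by have := Int.emod_lt_of_pos k hdZ; omega, ?_⟩
    open scoped Pointwise in
    have hmod := MulAction.zpow_smul_mod_minimalPeriod (f.toEquiv : Equiv.Perm X) h k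
    change ⇑((f.toEquiv : Equiv.Perm X) ^ (k % (d : ℤ))) '' h =
      ⇑((f.toEquiv : Equiv.Perm X) ^ k) '' h at hmod
    rw [← hmod, hj, zpow_natCast, Equiv.Perm.coe_pow]
    rfl
end
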